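/- arXiv:2001.08881 — 4 statements merged into one kernel-verified Lean document; each statement's English description precedes it below -/
import Mathlib

section
/- For every integer α ≥ 4, there exists a connected finite simple graph with independence number α having independence roots at i and −i. -/
open scoped Classical
open Polynomial

/-- `s` is an independent set of the simple graph `G`. -/
def SimpleGraph.IsIndepFinset {V : Type} (G : SimpleGraph V) (s : Finset V) : Prop :=
  ∀ u ∈ s, ∀ v ∈ s, ¬ G.Adj u v

/-- The independence polynomial of `G`, as a polynomial over `ℂ`:
`I(G,x) = ∑_k s_k x^k` where `s_k` is the number of independent sets of cardinality `k`. -/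
noncomputable def indepPoly {V : Type} [Fintype V] (G : SimpleGraph V) : Polynomial ℂ :=
  ∑ s ∈ Finset.univ.filter (fun s : Finset V => G.IsIndepFinset s), (X : Polynomial ℂ) ^ s.card

/-- The independence number of `G`. -/
noncomputable def indepNum {V : Type} [Fintype V] (G : SimpleGraph V) : ℕ :=
  (Finset.univ.filter (fun s : Finset V => G.IsIndepFinset s)).sup Finset.card

/-- The join `G + H` of two graphs: their disjoint union together with
all edges between the two parts. -/
def graphJoin {α β : Type} (G : SimpleGraph α) (H : SimpleGraph β) : SimpleGraph (α ⊕ β) where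
  Adj x y :=
    match x, y with
    | Sum.inl a, Sum.inl b => G.Adj a b
    | Sum.inr a, Sum.inr b => H.Adj a b
    | Sum.inl _, Sum.inr _ => True
    | Sum.inr _, Sum.inl _ => True
  symm := by
    constructor
    rintro (a | a) (b | b) h
    · exact G.symm.symm _ _ h
    · trivial
    · trivial
    · exact H.symm.symm _ _ h
  loopless := by
    constructor
    rintro (a | a) h
    · exact G.loopless.irrefl a h
    · exact H.loopless.irrefl a h

/-- `mK_n` : the disjoint union of `m` copies of the complete graph `K_n`. -/
def mClique (m n : ℕ) : SimpleGraph (Fin m × Fin n) where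
  Adj x y := x.1 = y.1 ∧ x ≠ y
  symm := by constructor; rintro x y ⟨h1, h2⟩; exact ⟨h1.symm, h2.symm⟩
  loopless := by constructor; rintro x ⟨_, h⟩; exact h rfl

/-- The lexicographic product `G[H]`. -/
def lexProd {α β : Type} (G : SimpleGraph α) (H : SimpleGraph β) : SimpleGraph (α × β) where
  Adj x y := G.Adj x.1 y.1 ∨ (x.1 = y.1 ∧ H.Adj x.2 y.2)
  symm := by
    constructor
    rintro x y (h | ⟨h1, h2⟩)
    · exact Or.inl (G.symm.symm _ _ h)
    · exact Or.inr ⟨h1.symm, H.symm.symm _ _ h2⟩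
  loopless := by
    constructor
    rintro x (h | ⟨-, h⟩)
    · exact G.loopless.irrefl _ h
    · exact H.loopless.irrefl _ h

/-- The corona `G ∘ H`: for each vertex `v` of `G`, add a new copy of `H`
joined completely to `v`. -/
def corona {α β : Type} (G : SimpleGraph α) (H : SimpleGraph β) : SimpleGraph (α ⊕ α × β) where
  Adj x y :=
    match x, y with
    | Sum.inl a, Sum.inl b => G.Adj a b
    | Sum.inl a, Sum.inr b => a = b.1
    | Sum.inr a, Sum.inl b => b = a.1
    | Sum.inr a, Sum.inr b => a.1 = b.1 ∧ H.Adj a.2 b.2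
  symm := by
    constructor
    rintro (a | a) (b | b) h
    · exact G.symm.symm _ _ h
    · exact h
    · exact h
    · exact ⟨h.1.symm, H.symm.symm _ _ h.2⟩
  loopless := by
    constructor
    rintro (a | a) h
    · exact G.loopless.irrefl a h
    · exact H.loopless.irrefl a.2 h.2

/-- The finset of all independent sets of `G`. -/
noncomputable def indepFinsets {V : Type} [Fintype V] (G : SimpleGraph V) : Finset (Finset V) :=
  Finset.univ.filter fun s => G.IsIndepFinset s

theorem mem_indepFinsets {V : Type} [Fintype V] {G : SimpleGraph V} {s : Finset V} :
    s ∈ indepFinsets G ↔ ∀ u ∈ s, ∀ v ∈ s, ¬ G.Adj u v := by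
  rw [indepFinsets, Finset.mem_filter_univ, SimpleGraph.IsIndepFinset]

theorem indepPoly_eq_sum {V : Type} [Fintype V] (G : SimpleGraph V) :
    indepPoly G = ∑ s ∈ indepFinsets G, (X : ℂ[X]) ^ s.card := rfl

theorem indepNum_eq_sup {V : Type} [Fintype V] (G : SimpleGraph V) :
    indepNum G = (indepFinsets G).sup Finset.card := rfl

theorem indepPoly_eval {V : Type} [Fintype V] (G : SimpleGraph V) (x : ℂ) :
    (indepPoly G).eval x = ∑ s ∈ indepFinsets G, x ^ s.card := by
  simp [indepPoly_eq_sum, eval_finsetSum]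

theorem indepPoly_eval_conj {V : Type} [Fintype V] (G : SimpleGraph V) (x : ℂ) :
    (indepPoly G).eval (starRingEnd ℂ x) = starRingEnd ℂ ((indepPoly G).eval x) := by
  simp [indepPoly_eval]

/-! ### Invariance under isomorphism -/

theorem indepFinsets_eq_map_of_iso {V W : Type} [Fintype V] [Fintype W] {G : SimpleGraph V}
    {H : SimpleGraph W} (e : G ≃g H) :
    indepFinsets H =
      (indepFinsets G).map (Finset.mapEmbedding e.toEquiv.toEmbedding).toEmbedding := by
  ext t
  simp only [Finset.mem_map, RelEmbedding.coe_toEmbedding, Finset.mapEmbedding_apply]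
  constructor
  · intro ht
    refine ⟨t.map e.symm.toEquiv.toEmbedding, ?_, ?_⟩
    · rw [mem_indepFinsets] at ht ⊢
      simp only [Finset.forall_mem_map]
      intro u hu v hv h
      exact ht u hu v hv (e.symm.map_adj_iff.1 h)
    · ext x
      rw [Finset.mem_map_equiv, Finset.mem_map_equiv]
      change e (e.symm x) ∈ t ↔ x ∈ t
      rw [e.apply_symm_apply]
  · rintro ⟨s, hs, rfl⟩
    rw [mem_indepFinsets] at hs ⊢
    simp only [Finset.forall_mem_map]
    intro u hu v hv h
    exact hs u hu v hv (e.map_adj_iff.1 h)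

theorem indepPoly_eq_of_iso {V W : Type} [Fintype V] [Fintype W] {G : SimpleGraph V}
    {H : SimpleGraph W} (e : G ≃g H) : indepPoly H = indepPoly G := by
  simp [indepPoly_eq_sum, indepFinsets_eq_map_of_iso e, Finset.sum_map]

theorem indepNum_eq_of_iso {V W : Type} [Fintype V] [Fintype W] {G : SimpleGraph V}
    {H : SimpleGraph W} (e : G ≃g H) : indepNum H = indepNum G := by
  simp [indepNum_eq_sup, indepFinsets_eq_map_of_iso e, Finset.sup_map, Function.comp_def]

/-! ### Joins -/

theorem indepFinsets_graphJoin {V W : Type} [Fintype V] [Fintype W] (G : SimpleGraph V)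
    (H : SimpleGraph W) :
    indepFinsets (graphJoin G H) =
      (indepFinsets G).map (Finset.mapEmbedding Function.Embedding.inl).toEmbedding ∪
        (indepFinsets H).map (Finset.mapEmbedding Function.Embedding.inr).toEmbedding := by
  ext t
  simp only [Finset.mem_union, Finset.mem_map, RelEmbedding.coe_toEmbedding,
    Finset.mapEmbedding_apply]
  constructor
  · intro ht
    rw [mem_indepFinsets] at ht
    by_cases h : ∃ v, Sum.inl v ∈ t
    · obtain ⟨v, hv⟩ := h
      refine Or.inl ⟨t.toLeft, ?_, ?_⟩
      · rw [mem_indepFinsets]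
        intro a ha b hb hab
        exact ht _ (Finset.mem_toLeft.1 ha) _ (Finset.mem_toLeft.1 hb) hab
      · ext (a | b)
        · simp
        · simpa using fun hb => ht (Sum.inl v) hv (Sum.inr b) hb trivial
    · refine Or.inr ⟨t.toRight, ?_, ?_⟩
      · rw [mem_indepFinsets]
        intro a ha b hb hab
        exact ht _ (Finset.mem_toRight.1 ha) _ (Finset.mem_toRight.1 hb) hab
      · ext (a | b)
        · simpa using fun ha => h ⟨a, ha⟩
        · simp
  · rintro (⟨s, hs, rfl⟩ | ⟨s, hs, rfl⟩) <;>
    · rw [mem_indepFinsets] at hs ⊢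
      simp only [Finset.forall_mem_map]
      exact hs

theorem indepPoly_graphJoin {V W : Type} [Fintype V] [Fintype W] (G : SimpleGraph V)
    (H : SimpleGraph W) :
    indepPoly (graphJoin G H) + 1 = indepPoly G + indepPoly H := by
  have hinter : (indepFinsets G).map
        (Finset.mapEmbedding (Function.Embedding.inl (β := W))).toEmbedding ∩
      (indepFinsets H).map (Finset.mapEmbedding (Function.Embedding.inr (α := V))).toEmbedding
      = {∅} := by
    ext t
    simp only [Finset.mem_inter, Finset.mem_map, RelEmbedding.coe_toEmbedding,
      Finset.mapEmbedding_apply, Finset.mem_singleton]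
    constructor
    · rintro ⟨⟨s, -, rfl⟩, s', -, h⟩
      rw [Finset.map_eq_empty, Finset.eq_empty_iff_forall_notMem]
      intro v hv
      have hmem : (Sum.inl v : V ⊕ W) ∈ s'.map Function.Embedding.inr := by
        rw [h]; simpa using hv
      simp at hmem
    · rintro rfl
      exact ⟨⟨∅, by simp [mem_indepFinsets], rfl⟩, ∅, by simp [mem_indepFinsets], rfl⟩
  have h := Finset.sum_union_inter (f := fun s : Finset (V ⊕ W) => (X : ℂ[X]) ^ s.card)
    (s₁ := (indepFinsets G).map (Finset.mapEmbedding Function.Embedding.inl).toEmbedding)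
    (s₂ := (indepFinsets H).map (Finset.mapEmbedding Function.Embedding.inr).toEmbedding)
  rw [hinter, ← indepFinsets_graphJoin, ← indepPoly_eq_sum] at h
  simpa [Finset.sum_map, ← indepPoly_eq_sum] using h

theorem indepNum_graphJoin {V W : Type} [Fintype V] [Fintype W] (G : SimpleGraph V)
    (H : SimpleGraph W) :
    indepNum (graphJoin G H) = max (indepNum G) (indepNum H) := by
  simp [indepNum_eq_sup, indepFinsets_graphJoin, Finset.sup_union, Finset.sup_map,
    Function.comp_def]

theorem connected_graphJoin {V W : Type} [Nonempty V] [Nonempty W] (G : SimpleGraph V)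
    (H : SimpleGraph W) : (graphJoin G H).Connected := by
  obtain ⟨v₀⟩ := ‹Nonempty V›
  obtain ⟨w₀⟩ := ‹Nonempty W›
  have hlr (v : V) (w : W) : (graphJoin G H).Reachable (Sum.inl v) (Sum.inr w) :=
    SimpleGraph.Adj.reachable (G := graphJoin G H) trivial
  refine (SimpleGraph.connected_iff_exists_forall_reachable _).2 ⟨Sum.inl v₀, ?_⟩
  rintro (v | w)
  · exact (hlr v₀ w₀).trans (hlr v w₀).symm
  · exact hlr v₀ w

/-! ### Disjoint unions -/

theorem indepFinsets_sum {V W : Type} [Fintype V] [Fintype W] (G : SimpleGraph V)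
    (H : SimpleGraph W) :
    indepFinsets (G ⊕g H) =
      (indepFinsets G ×ˢ indepFinsets H).map Finset.sumEquiv.symm.toEquiv.toEmbedding := by
  ext t
  simp [Finset.mem_map_equiv, mem_indepFinsets]

theorem indepPoly_sum {V W : Type} [Fintype V] [Fintype W] (G : SimpleGraph V)
    (H : SimpleGraph W) : indepPoly (G ⊕g H) = indepPoly G * indepPoly H := by
  simp [indepPoly_eq_sum, indepFinsets_sum, Finset.sum_map, Finset.sum_product,
    Finset.sum_mul_sum, pow_add]

theorem indepNum_sum_le {V W : Type} [Fintype V] [Fintype W] (G : SimpleGraph V)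
    (H : SimpleGraph W) : indepNum (G ⊕g H) ≤ indepNum G + indepNum H := by
  simp only [indepNum_eq_sup, indepFinsets_sum, Finset.sup_map]
  refine Finset.sup_le fun p hp => ?_
  rw [Finset.mem_product] at hp
  simpa using add_le_add (Finset.le_sup (f := Finset.card) hp.1)
    (Finset.le_sup (f := Finset.card) hp.2)

/-! ### Edgeless graphs -/

theorem indepFinsets_bot (V : Type) [Fintype V] :
    indepFinsets (⊥ : SimpleGraph V) = Finset.univ := by
  ext s
  simp [mem_indepFinsets]

theorem indepPoly_bot (V : Type) [Fintype V] :
    indepPoly (⊥ : SimpleGraph V) = (X + 1) ^ Fintype.card V := by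
  rw [indepPoly_eq_sum, indepFinsets_bot, ← Fintype.sum_pow_mul_eq_add_pow]
  simp

theorem indepNum_bot (V : Type) [Fintype V] :
    indepNum (⊥ : SimpleGraph V) = Fintype.card V := by
  rw [indepNum_eq_sup, indepFinsets_bot]
  exact le_antisymm (Finset.sup_le fun s _ => s.card_le_univ)
    (Finset.le_sup (f := Finset.card) (Finset.mem_univ Finset.univ))

/-! ### Values at `i` -/

/-- The numbers `I(G,i) - 1`, where `G` ranges over the finite graphs of independence number
at most `k`. They are closed under addition because of joins. -/
def indepValues (k : ℕ) : AddSubmonoid ℂ where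
  carrier := {z | ∃ (V : Type) (_ : Fintype V) (G : SimpleGraph V),
    indepNum G ≤ k ∧ (indepPoly G).eval Complex.I = z + 1}
  zero_mem' := ⟨Empty, inferInstance, ⊥, by simp [indepNum_bot], by simp [indepPoly_bot]⟩
  add_mem' := by
    rintro z w ⟨V, _, G, hG, hz⟩ ⟨W, _, H, hH, hw⟩
    refine ⟨V ⊕ W, inferInstance, graphJoin G H, by simp [indepNum_graphJoin, hG, hH], ?_⟩
    have h := congrArg (eval Complex.I) (indepPoly_graphJoin G H)
    simp only [eval_add, eval_one, hz, hw] at h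
    linear_combination h

theorem mul_mem_indepValues {j k : ℕ} {z w : ℂ} (hz : z ∈ indepValues j)
    (hw : w ∈ indepValues k) : (z + 1) * (w + 1) - 1 ∈ indepValues (j + k) := by
  obtain ⟨V, _, G, hG, hz⟩ := hz
  obtain ⟨W, _, H, hH, hw⟩ := hw
  exact ⟨V ⊕ W, inferInstance, G ⊕g H, (indepNum_sum_le G H).trans (add_le_add hG hH),
    by simp [indepPoly_sum, hz, hw]⟩

theorem indepValues_mono {j k : ℕ} (h : j ≤ k) : indepValues j ≤ indepValues k :=
  fun _ ⟨V, i, G, hG, hz⟩ => ⟨V, i, G, hG.trans h, hz⟩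

theorem I_mem_indepValues_one : Complex.I ∈ indepValues 1 :=
  ⟨Unit, inferInstance, ⊥, by simp [indepNum_bot], by simp [indepPoly_bot]⟩

theorem units_mem_indepValues_four :
    Complex.I ∈ indepValues 4 ∧ -Complex.I ∈ indepValues 4 ∧
      (1 : ℂ) ∈ indepValues 4 ∧ (-1 : ℂ) ∈ indepValues 4 := by
  have hI2 : Complex.I ^ 2 = -1 := Complex.I_sq
  have hI : Complex.I ∈ indepValues 4 := indepValues_mono (by norm_num) I_mem_indepValues_one
  have h2 := indepValues_mono (show 1 + 1 ≤ 4 by norm_num)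
    (mul_mem_indepValues I_mem_indepValues_one I_mem_indepValues_one)
  have h3 := nsmul_mem I_mem_indepValues_one 3
  have h33 := mul_mem_indepValues h3 h3
  -- the value `27 - 96 i` of the disjoint union of four triangles
  have h4 : (27 - 96 * Complex.I : ℂ) ∈ indepValues 4 := by
    convert mul_mem_indepValues h33 h33 using 1
    simp only [nsmul_eq_mul]
    push_cast
    linear_combination (-81 * Complex.I ^ 2 - 108 * Complex.I + 27) * hI2
  have hneg : (-1 : ℂ) ∈ indepValues 4 := by
    convert add_mem h4 (add_mem (nsmul_mem h2 28) (nsmul_mem hI 40)) using 1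
    simp only [nsmul_eq_mul]
    push_cast
    linear_combination (-28) * hI2
  refine ⟨hI, ?_, ?_, hneg⟩
  · convert add_mem h4 (add_mem (nsmul_mem hneg 27) (nsmul_mem hI 95)) using 1
    simp only [nsmul_eq_mul]
    push_cast
    ring
  · convert add_mem h4 (add_mem (nsmul_mem hneg 26) (nsmul_mem hI 96)) using 1
    simp only [nsmul_eq_mul]
    push_cast
    ring

theorem zsmul_mem_of_neg_mem {A : Type*} [AddGroup A] {S : AddSubmonoid A} {x : A}
    (hx : x ∈ S) (hnx : -x ∈ S) (n : ℤ) : n • x ∈ S := by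
  obtain ⟨m, rfl | rfl⟩ := n.eq_nat_or_neg
  · simpa using nsmul_mem hx m
  · simpa using nsmul_mem hnx m

theorem gaussianInt_mem_indepValues_four (a b : ℤ) :
    (a + b * Complex.I : ℂ) ∈ indepValues 4 := by
  obtain ⟨hI, hnI, h1, hn1⟩ := units_mem_indepValues_four
  simpa using add_mem (zsmul_mem_of_neg_mem h1 hn1 a) (zsmul_mem_of_neg_mem hI hnI b)

theorem exists_I_add_one_pow_eq (n : ℕ) :
    ∃ a b : ℤ, (Complex.I + 1) ^ n = a + b * Complex.I := by
  induction n with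
  | zero => exact ⟨1, 0, by simp⟩
  | succ n ih =>
    obtain ⟨a, b, h⟩ := ih
    refine ⟨a - b, a + b, ?_⟩
    rw [pow_succ, h]
    push_cast
    linear_combination (b : ℂ) * Complex.I_sq

/-- For every integer `α ≥ 4`, there exists a connected finite simple graph with independence
number `α` having independence roots at `i` and `−i`. -/
theorem exists_connected_graph_with_root_I (α : ℕ) (hα : 4 ≤ α) :
    ∃ (n : ℕ) (G : SimpleGraph (Fin n)),
      G.Connected ∧ indepNum G = α ∧
      (indepPoly G).eval Complex.I = 0 ∧ (indepPoly G).eval (-Complex.I) = 0 := by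
  obtain ⟨a, b, hab⟩ := exists_I_add_one_pow_eq α
  obtain ⟨V, _, H, hH, hval⟩ := gaussianInt_mem_indepValues_four (-a) (-b)
  have hpow : (Complex.I + 1) ^ α ≠ 0 :=
    pow_ne_zero _ fun h => by simpa using congrArg Complex.im h
  have hV : Nonempty V := by
    by_contra hV
    rw [not_nonempty_iff] at hV
    apply hpow
    rw [Subsingleton.elim H ⊥, indepPoly_bot] at hval
    simp at hval
    linear_combination hab - hval
  have : Nonempty (Fin α) := ⟨⟨0, by omega⟩⟩
  set J := graphJoin (⊥ : SimpleGraph (Fin α)) H with hJ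
  have hroot : (indepPoly J).eval Complex.I = 0 := by
    have h := congrArg (eval Complex.I) (indepPoly_graphJoin (⊥ : SimpleGraph (Fin α)) H)
    simp only [eval_add, eval_one, hval, indepPoly_bot, Fintype.card_fin, eval_pow, eval_X, hab]
      at h
    push_cast at h
    linear_combination h
  have e : J ≃g _ := SimpleGraph.Iso.map (Fintype.equivFin (Fin α ⊕ V)) J
  refine ⟨_, _, e.connected_iff.1 (connected_graphJoin _ _), ?_, ?_, ?_⟩
  · rw [indepNum_eq_of_iso e, hJ, indepNum_graphJoin, indepNum_bot, Fintype.card_fin]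
    omega
  · rw [indepPoly_eq_of_iso e, hroot]
  · rw [indepPoly_eq_of_iso e, ← Complex.conj_I, indepPoly_eval_conj, hroot, map_zero]
end

section
/- Let b be a nonzero rational number. Then bi is an independence root of some finite simple graph if and only if b = 1/n for some nonzero integer n. -/
open scoped Classical
open Polynomial

theorem indepPoly_comap_equiv {V W : Type} [Fintype V] [Fintype W] (e : V ≃ W)
    (G : SimpleGraph W) : indepPoly (G.comap e) = indepPoly G := by
  unfold indepPoly
  refine Finset.sum_equiv e.finsetCongr ?_ ?_
  · intro s
    simp only [Finset.mem_filter, Finset.mem_univ, true_and]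
    constructor
    · intro h u hu v hv
      simpa using h (e.symm u) (by simpa using hu) (e.symm v) (by simpa using hv)
    · intro h u hu v hv
      exact h (e u) (by simpa using hu) (e v) (by simpa using hv)
  · intro s _
    simp

theorem indepPoly_mClique (m n : ℕ) :
    indepPoly (mClique m n) = (1 + (n : ℂ[X]) * X) ^ m := by
  have hpow : (1 + (n : ℂ[X]) * X) ^ m =
      ∑ f : Fin m → Option (Fin n), ∏ i, (f i).elim 1 fun _ => (X : ℂ[X]) := by
    have h := Finset.prod_univ_sum (fun _ : Fin m => (Finset.univ : Finset (Option (Fin n))))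
      (fun _ o => o.elim 1 fun _ => (X : ℂ[X]))
    simpa [Fintype.sum_option] using h
  rw [hpow]
  unfold indepPoly
  symm
  refine Finset.sum_bij (fun f _ => Finset.univ.filter fun p : Fin m × Fin n => f p.1 = some p.2)
    ?_ ?_ ?_ ?_
  · intro f _
    simp only [Finset.mem_filter, Finset.mem_univ, true_and]
    rintro ⟨i, j⟩ hu ⟨i', j'⟩ hv ⟨rfl, hne⟩
    simp_all
  · intro f _ g _ h
    funext i
    ext j
    simpa using Finset.ext_iff.mp h (i, j)
  · intro s hs
    simp only [Finset.mem_filter, Finset.mem_univ, true_and] at hs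
    refine ⟨fun i => if h : ∃ j, (i, j) ∈ s then some h.choose else none, Finset.mem_univ _, ?_⟩
    ext ⟨i, j⟩
    simp only [Finset.mem_filter, Finset.mem_univ, true_and]
    constructor
    · intro h
      split_ifs at h with hex
      rw [← Option.some.inj h]
      exact hex.choose_spec
    · intro h
      have hex : ∃ j, (i, j) ∈ s := ⟨j, h⟩
      rw [dif_pos hex]
      by_contra hne
      exact hs _ hex.choose_spec _ h ⟨rfl, fun heq => hne (congrArg some (Prod.ext_iff.mp heq).2)⟩
  · intro f _
    rw [← Finset.prod_const, Finset.prod_filter, Fintype.prod_prod_type]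
    refine Finset.prod_congr rfl fun i _ => ?_
    cases h : f i <;> simp [h]

theorem isIndepFinset_graphJoin_iff {α β : Type} (G : SimpleGraph α) (H : SimpleGraph β)
    (s : Finset (α ⊕ β)) :
    (graphJoin G H).IsIndepFinset s ↔
      (∃ t, G.IsIndepFinset t ∧ t.map .inl = s) ∨ ∃ t, H.IsIndepFinset t ∧ t.map .inr = s := by
  constructor
  · intro hs
    by_cases hr : s.toRight = ∅
    · refine Or.inl ⟨s.toLeft, fun u hu v hv => ?_, ?_⟩
      · exact hs _ (Finset.mem_toLeft.mp hu) _ (Finset.mem_toLeft.mp hv)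
      · ext (a | b)
        · simp
        · have : b ∉ s.toRight := by simp [hr]
          simpa using this
    · obtain ⟨b, hb⟩ := Finset.nonempty_iff_ne_empty.mpr hr
      refine Or.inr ⟨s.toRight, fun u hu v hv => ?_, ?_⟩
      · exact hs _ (Finset.mem_toRight.mp hu) _ (Finset.mem_toRight.mp hv)
      · ext (a | b')
        · have : Sum.inl a ∉ s := fun ha => hs _ ha _ (Finset.mem_toRight.mp hb) trivial
          simpa using this
        · simp
  · rintro (⟨t, ht, rfl⟩ | ⟨t, ht, rfl⟩) u hu v hv
    all_goals
      obtain ⟨a, ha, rfl⟩ := Finset.mem_map.mp hu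
      obtain ⟨b, hb, rfl⟩ := Finset.mem_map.mp hv
      exact ht a ha b hb

theorem indepPoly_graphJoin_add_one {α β : Type} [Fintype α] [Fintype β] (G : SimpleGraph α)
    (H : SimpleGraph β) : indepPoly (graphJoin G H) + 1 = indepPoly G + indepPoly H := by
  set A := (Finset.univ.filter fun s => G.IsIndepFinset s).map
    (Finset.mapEmbedding (.inl : α ↪ α ⊕ β)).toEmbedding with hA
  set B := (Finset.univ.filter fun s => H.IsIndepFinset s).map
    (Finset.mapEmbedding (.inr : β ↪ α ⊕ β)).toEmbedding with hB
  have hunion : (Finset.univ.filter fun s => (graphJoin G H).IsIndepFinset s) = A ∪ B := by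
    ext s
    simp [hA, hB, isIndepFinset_graphJoin_iff]
  have hinter : A ∩ B = {∅} := by
    ext s
    simp only [hA, hB, Finset.mem_inter, Finset.mem_map, Finset.mem_filter, Finset.mem_univ,
      true_and, Finset.mem_singleton, RelEmbedding.coe_toEmbedding, Finset.mapEmbedding_apply]
    constructor
    · rintro ⟨⟨t, -, rfl⟩, ⟨t', -, h⟩⟩
      rw [Finset.eq_empty_iff_forall_notMem]
      rintro (a | b) hx
      · rw [← h] at hx
        simp at hx
      · simp at hx
    · rintro rfl
      exact ⟨⟨∅, by simp [SimpleGraph.IsIndepFinset]⟩, ⟨∅, by simp [SimpleGraph.IsIndepFinset]⟩⟩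
  have h := Finset.sum_union_inter (s₁ := A) (s₂ := B) (f := fun s => (X : ℂ[X]) ^ s.card)
  rw [← hunion, hinter] at h
  simpa [hA, hB, indepPoly] using h

theorem exists_graph_eval_indepPoly_eq_zero (n : ℕ) {x : ℂ}
    (hx : (1 + n * x) ^ 6 + 8 * n * x = 0) :
    ∃ (m : ℕ) (G : SimpleGraph (Fin m)), (indepPoly G).eval x = 0 := by
  let G := graphJoin (mClique 6 n) (mClique 1 (8 * n))
  refine ⟨_, G.comap (Fintype.equivFin _).symm, ?_⟩
  rw [indepPoly_comap_equiv]
  have h := congrArg (eval x) (indepPoly_graphJoin_add_one (mClique 6 n) (mClique 1 (8 * n)))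
  simp only [indepPoly_mClique, eval_add, eval_pow, eval_mul, eval_one, eval_natCast, eval_X] at h
  push_cast at h
  linear_combination h + hx

/-- The constant term of the independence polynomial is `1`, so reversing it gives a monic
integer polynomial. -/
theorem isIntegral_inv_of_eval_indepPoly_eq_zero {V : Type} [Fintype V] (G : SimpleGraph V)
    {x : ℂ} (hx : (indepPoly G).eval x = 0) : IsIntegral ℤ x⁻¹ := by
  set S := Finset.univ.filter (fun s : Finset V => G.IsIndepFinset s) with hS
  have hempty : ∅ ∈ S := by
    rw [hS, Finset.mem_filter]
    simp [SimpleGraph.IsIndepFinset]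
  set N := Fintype.card V
  have hx0 : x ≠ 0 := by
    rintro rfl
    rw [indepPoly, ← hS, eval_finsetSum, ← Finset.add_sum_erase _ _ hempty,
      Finset.sum_eq_zero] at hx
    · simp at hx
    · intro s hs
      simp [Finset.ne_of_mem_erase hs]
  refine ⟨X ^ N + ∑ s ∈ S.erase ∅, X ^ (N - s.card), monic_X_pow_add ?_, ?_⟩
  · rw [degree_lt_iff_coeff_zero]
    intro k hk
    rw [finsetSum_coeff]
    refine Finset.sum_eq_zero fun s hs => ?_
    have hpos := Finset.card_pos.mpr (Finset.nonempty_iff_ne_empty.mpr (Finset.ne_of_mem_erase hs))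
    have hle : s.card ≤ N := Finset.card_le_univ s
    rw [coeff_X_pow, if_neg (by lia)]
  · have hterm : ∀ s : Finset V, x⁻¹ ^ (N - s.card) = x⁻¹ ^ N * x ^ s.card := by
      intro s
      rw [pow_sub₀ _ (inv_ne_zero hx0) (Finset.card_le_univ s), inv_pow x s.card, inv_inv]
    have h : ∑ s ∈ S, x ^ s.card = 0 := by
      simpa [indepPoly, eval_finsetSum, hS] using hx
    rw [← Finset.add_sum_erase _ _ hempty] at h
    simp only [eval₂_add, eval₂_X_pow, eval₂_finsetSum, hterm, ← Finset.mul_sum]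
    simp only [Finset.card_empty, pow_zero] at h
    linear_combination x⁻¹ ^ N * h

/-- For a nonzero rational `b`, `bi` is an independence root of some finite simple graph if
and only if `b = 1/n` for some nonzero integer `n`. -/
theorem rational_purely_imaginary_root_iff (b : ℚ) (hb : b ≠ 0) :
    (∃ (m : ℕ) (G : SimpleGraph (Fin m)),
        (indepPoly G).eval ((b : ℂ) * Complex.I) = 0) ↔
      ∃ n : ℤ, n ≠ 0 ∧ b = 1 / (n : ℚ) := by
  constructor
  · rintro ⟨m, G, hG⟩
    have hInt : IsIntegral ℤ (((b⁻¹ : ℚ) : ℂ)) := by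
      have hI : IsIntegral ℤ Complex.I := ⟨X ^ 2 + 1, by monicity!, by simp⟩
      have h := (isIntegral_inv_of_eval_indepPoly_eq_zero G hG).mul hI
      have heq : ((b : ℂ) * Complex.I)⁻¹ * Complex.I = ((b⁻¹ : ℚ) : ℂ) := by
        push_cast
        rw [mul_inv, mul_assoc, inv_mul_cancel₀ Complex.I_ne_zero, mul_one]
      rwa [heq] at h
    have hq : IsIntegral ℤ (b⁻¹ : ℚ) :=
      (isIntegral_algebraMap_iff (algebraMap ℚ ℂ).injective).mp hInt
    obtain ⟨n, hn⟩ := IsIntegrallyClosed.isIntegral_iff.mp hq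
    rw [eq_intCast] at hn
    refine ⟨n, ?_, by rw [hn, one_div, inv_inv]⟩
    rintro rfl
    exact inv_ne_zero hb (by simpa using hn.symm)
  · rintro ⟨n, hn, rfl⟩
    have hn' : (n : ℂ) ≠ 0 := Int.cast_ne_zero.mpr hn
    have hI2 := Complex.I_sq
    have hpos : (1 + Complex.I) ^ 6 + 8 * Complex.I = 0 := by
      linear_combination
        (Complex.I ^ 4 + 6 * Complex.I ^ 3 + 14 * Complex.I ^ 2 + 14 * Complex.I + 1) * hI2
    have hneg : (1 - Complex.I) ^ 6 - 8 * Complex.I = 0 := by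
      linear_combination
        (Complex.I ^ 4 - 6 * Complex.I ^ 3 + 14 * Complex.I ^ 2 - 14 * Complex.I + 1) * hI2
    obtain ⟨N, rfl | rfl⟩ := Int.eq_nat_or_neg n
    all_goals
      push_cast at hn' ⊢
      refine exists_graph_eval_indepPoly_eq_zero N ?_
    · rw [← hpos]
      field_simp
    · rw [neg_ne_zero] at hn'
      rw [← hneg]
      field_simp
      ring
end

section
/- Let b be a rational number with |b| > 1. Then neither bi nor i√b (for b > 0, the complex number with real part 0 and imaginary part √b) is an independence root of any finite simple graph. -/
open scoped Classical
open Polynomial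

/-- The independence polynomial with integer coefficients. -/
noncomputable def intIndepPoly {V : Type} [Fintype V] (G : SimpleGraph V) : ℤ[X] :=
  ∑ s ∈ Finset.univ.filter (fun s : Finset V => G.IsIndepFinset s), (X : ℤ[X]) ^ s.card

theorem aeval_intIndepPoly {V : Type} [Fintype V] (G : SimpleGraph V) (x : ℂ) :
    aeval x (intIndepPoly G) = (indepPoly G).eval x := by
  simp [intIndepPoly, indepPoly, eval_finsetSum]

theorem coeff_zero_intIndepPoly {V : Type} [Fintype V] (G : SimpleGraph V) :
    (intIndepPoly G).coeff 0 = 1 := by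
  have hempty : G.IsIndepFinset ∅ := by simp [SimpleGraph.IsIndepFinset]
  rw [intIndepPoly, finsetSum_coeff, Finset.sum_eq_single ∅]
  · simp
  · intro s _ hs
    rw [coeff_X_pow, if_neg]
    simpa [eq_comm] using hs
  · simp [hempty]

/-- The inverse of a root of an integer polynomial with constant coefficient `1` is an algebraic
integer. -/
theorem isIntegral_inv_of_coeff_zero_eq_one {K : Type*} [Field K] {p : ℤ[X]}
    (hp : p.coeff 0 = 1) {x : K} (hx : aeval x p = 0) : IsIntegral ℤ x⁻¹ := by
  rcases eq_or_ne x 0 with rfl | hx0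
  · simpa using (isIntegral_zero : IsIntegral ℤ (0 : K))
  refine ⟨p.reverse, ?_, ?_⟩
  · rw [Monic, reverse_leadingCoeff, trailingCoeff, natTrailingDegree_eq_zero.2, hp]
    exact Or.inr (by simp [hp])
  · let := invertibleOfNonzero hx0
    rw [← invOf_eq_inv x]
    exact (eval₂_reverse_eq_zero_iff (algebraMap ℤ K) x p).2 hx

/-- A complex number whose square is a rational of absolute value greater than `1` is not an
independence root. -/
theorem eval_indepPoly_ne_zero_of_sq_eq {V : Type} [Fintype V] (G : SimpleGraph V) {x : ℂ}
    {c : ℚ} (hc : 1 < |c|) (hx : x ^ 2 = c) : (indepPoly G).eval x ≠ 0 := by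
  intro h
  rw [← aeval_intIndepPoly] at h
  have hsq := (isIntegral_inv_of_coeff_zero_eq_one (coeff_zero_intIndepPoly G) h).pow 2
  have hcast : (x⁻¹) ^ 2 = algebraMap ℚ ℂ c⁻¹ := by simp [hx]
  rw [hcast, isIntegral_algebraMap_iff (algebraMap ℚ ℂ).injective,
    IsIntegrallyClosed.isIntegral_iff] at hsq
  obtain ⟨n, hn⟩ := hsq
  have hn' : (n : ℚ) = c⁻¹ := by simpa using hn
  have hlt : |(n : ℚ)| < 1 := by
    rw [hn', abs_inv]
    exact inv_lt_one_of_one_lt₀ hc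
  have hn0 : n = 0 := Int.abs_lt_one_iff.1 (by exact_mod_cast hlt)
  have hc0 : c = 0 := by simpa [hn0, eq_comm] using hn'
  norm_num [hc0] at hc

/-- If `b` is rational with `|b| > 1`, then `bi` is not an independence root of any finite
simple graph, and (for `b > 0`) neither is `i√b`. -/
theorem not_root_of_abs_gt_one (b : ℚ) (hb : 1 < |b|) :
    (∀ (m : ℕ) (G : SimpleGraph (Fin m)),
        (indepPoly G).eval ((b : ℂ) * Complex.I) ≠ 0) ∧
    (0 < b → ∀ (m : ℕ) (G : SimpleGraph (Fin m)),
        (indepPoly G).eval ((Real.sqrt (b : ℝ) : ℂ) * Complex.I) ≠ 0) := by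
  refine ⟨fun m G => eval_indepPoly_ne_zero_of_sq_eq G (c := -b ^ 2) ?_ ?_,
    fun hpos m G => eval_indepPoly_ne_zero_of_sq_eq G (c := -b) ?_ ?_⟩
  · rw [abs_neg, abs_pow]
    exact one_lt_pow₀ hb two_ne_zero
  · simp [mul_pow]
  · rwa [abs_neg]
  · rw [mul_pow, ← Complex.ofReal_pow, Real.sq_sqrt (by exact_mod_cast hpos.le)]
    simp
end

section
/- For every nonzero integer n, there exist infinitely many trees (connected acyclic finite simple graphs, pairwise non-isomorphic) having independence roots at i/n and −i/n. -/
open scoped Classical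
open Polynomial

namespace SimpleGraph

section Link

variable {V W : Type} {G : SimpleGraph V} {H : SimpleGraph W} {r : V} {q : W}

/-- Joining two trees by an edge gives a tree. -/
lemma IsTree.sum_sup_edge [Finite V] [Finite W] (hG : G.IsTree) (hH : H.IsTree) :
    (G.sum H ⊔ edge (.inl r) (.inr q)).IsTree := by
  rw [isTree_iff_connected_and_card] at hG hH ⊢
  refine ⟨hG.1.sum_sup_edge hH.1, ?_⟩
  have hcard : Nat.card (G.sum H).edgeSet = Nat.card G.edgeSet + Nat.card H.edgeSet := by
    rw [Nat.card_congr edgeSetSumEquiv, Nat.card_sum]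
  have hnotMem : s(Sum.inl r, Sum.inr q) ∉ (G.sum H).edgeSet := by simp
  have hedge : (G.sum H ⊔ edge (.inl r) (.inr q)).edgeSet =
      insert s(Sum.inl r, Sum.inr q) (G.sum H).edgeSet := by
    rw [edgeSet_sup, edgeSet_edge_of_ne (by simp), Set.union_comm, Set.singleton_union]
  rw [hedge, Nat.card_coe_set_eq, Set.ncard_insert_of_notMem hnotMem, ← Nat.card_coe_set_eq,
    hcard, Nat.card_sum]
  omega

lemma isIndepFinset_disjSum_iff (s : Finset V) (t : Finset W) :
    (G.sum H ⊔ edge (.inl r) (.inr q)).IsIndepFinset (s.disjSum t) ↔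
      G.IsIndepFinset s ∧ H.IsIndepFinset t ∧ ¬ (r ∈ s ∧ q ∈ t) := by
  constructor
  · intro h
    refine ⟨fun u hu v hv huv => ?_, fun u hu v hv huv => ?_, fun ⟨hr, hq⟩ => ?_⟩
    · exact h (.inl u) (by simpa) (.inl v) (by simpa) (by simp [huv])
    · exact h (.inr u) (by simpa) (.inr v) (by simpa) (by simp [huv])
    · exact h (.inl r) (by simpa) (.inr q) (by simpa) (by simp [edge_adj])
  · rintro ⟨hs, ht, hrq⟩ (u | u) hu (v | v) hv <;>
      simp only [Finset.inl_mem_disjSum, Finset.inr_mem_disjSum] at hu hv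
    · simpa [edge_adj] using hs u hu v hv
    · simp only [sup_adj, not_adj_sum_inl_inr, edge_adj]
      rintro (h | h) <;> simp_all
    · simp only [sup_adj, edge_adj]
      rintro (h | h) <;> simp_all
    · simpa [edge_adj] using ht u hu v hv

end Link

section RootedSums

variable {V W : Type} [Fintype V] [Fintype W]

/-- The value at `x` of the part of the independence polynomial that counts the independent sets
avoiding `r`. -/
noncomputable def indepSumAvoiding (G : SimpleGraph V) (r : V) (x : ℂ) : ℂ :=
  ∑ s : Finset V, if G.IsIndepFinset s ∧ r ∉ s then x ^ s.card else 0

/-- The value at `x` of the part of the independence polynomial that counts the independent sets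
containing `r`. -/
noncomputable def indepSumContaining (G : SimpleGraph V) (r : V) (x : ℂ) : ℂ :=
  ∑ s : Finset V, if G.IsIndepFinset s ∧ r ∈ s then x ^ s.card else 0

lemma indepSumAvoiding_add_indepSumContaining (G : SimpleGraph V) (r : V) (x : ℂ) :
    G.indepSumAvoiding r x + G.indepSumContaining r x =
      ∑ s : Finset V, if G.IsIndepFinset s then x ^ s.card else 0 := by
  rw [indepSumAvoiding, indepSumContaining, ← Finset.sum_add_distrib]
  refine Finset.sum_congr rfl fun s _ => ?_
  by_cases h : r ∈ s <;> simp [h]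

lemma eval_indepPoly (G : SimpleGraph V) (x : ℂ) :
    (indepPoly G).eval x = ∑ s : Finset V, if G.IsIndepFinset s then x ^ s.card else 0 := by
  simp [indepPoly, eval_finsetSum, ← Finset.sum_filter]

lemma eval_conj_indepPoly (G : SimpleGraph V) (x : ℂ) :
    (indepPoly G).eval (starRingEnd ℂ x) = starRingEnd ℂ ((indepPoly G).eval x) := by
  simp [indepPoly, eval_finsetSum]

lemma eval_indepPoly_of_iso {G : SimpleGraph V} {H : SimpleGraph W} (e : G ≃g H) (x : ℂ) :
    (indepPoly H).eval x = (indepPoly G).eval x := by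
  rw [eval_indepPoly, eval_indepPoly]
  refine (Fintype.sum_equiv e.toEquiv.finsetCongr _ _ fun s => ?_).symm
  have h : H.IsIndepFinset (e.toEquiv.finsetCongr s) ↔ G.IsIndepFinset s := by
    simp only [IsIndepFinset, Equiv.finsetCongr_apply, Finset.forall_mem_map,
      Equiv.coe_toEmbedding, RelIso.coe_fn_toEquiv, e.map_adj_iff]
  rw [if_congr h rfl rfl]
  simp

lemma sum_finset_sum (f : Finset (V ⊕ W) → ℂ) :
    ∑ s, f s = ∑ s : Finset V, ∑ t : Finset W, f (s.disjSum t) := by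
  rw [← Fintype.sum_prod_type']
  exact (Fintype.sum_equiv Finset.sumEquiv.symm.toEquiv _ _ fun _ => rfl).symm

lemma indepSumAvoiding_sum_sup_edge (G : SimpleGraph V) (H : SimpleGraph W) (r : V) (q : W)
    (x : ℂ) :
    (G.sum H ⊔ edge (.inl r) (.inr q)).indepSumAvoiding (.inl r) x =
      G.indepSumAvoiding r x * (H.indepSumAvoiding q x + H.indepSumContaining q x) := by
  rw [indepSumAvoiding_add_indepSumContaining, indepSumAvoiding, indepSumAvoiding, sum_finset_sum,
    Finset.sum_mul_sum]
  refine Finset.sum_congr rfl fun s _ => Finset.sum_congr rfl fun t _ => ?_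
  simp only [isIndepFinset_disjSum_iff, Finset.inl_mem_disjSum, ite_zero_mul_ite_zero,
    Finset.card_disjSum, pow_add]
  congr 1
  grind

lemma indepSumContaining_sum_sup_edge (G : SimpleGraph V) (H : SimpleGraph W) (r : V) (q : W)
    (x : ℂ) :
    (G.sum H ⊔ edge (.inl r) (.inr q)).indepSumContaining (.inl r) x =
      G.indepSumContaining r x * H.indepSumAvoiding q x := by
  rw [indepSumContaining, indepSumContaining, indepSumAvoiding, sum_finset_sum,
    Finset.sum_mul_sum]
  refine Finset.sum_congr rfl fun s _ => Finset.sum_congr rfl fun t _ => ?_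
  simp only [isIndepFinset_disjSum_iff, Finset.inl_mem_disjSum, ite_zero_mul_ite_zero,
    Finset.card_disjSum, pow_add]
  congr 1
  grind

end RootedSums

end SimpleGraph

/-- Some rooted tree with `m` vertices has independent-set sums `P` (avoiding the root) and `Q`
(containing the root) at `x`. -/
def IsRootedTreeValue (x : ℂ) (m : ℕ) (P Q : ℂ) : Prop :=
  ∃ (V : Type) (_ : Fintype V) (G : SimpleGraph V) (r : V), Fintype.card V = m ∧ G.IsTree ∧
    G.indepSumAvoiding r x = P ∧ G.indepSumContaining r x = Q

namespace IsRootedTreeValue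

variable {x P Q P' Q' : ℂ} {m m' : ℕ}

lemma single (x : ℂ) : IsRootedTreeValue x 1 1 x := by
  have huniv : (Finset.univ : Finset (Finset Unit)) = {∅, {()}} := by decide
  refine ⟨Unit, inferInstance, ⊥, (), rfl, .of_subsingleton, ?_, ?_⟩ <;>
    simp [SimpleGraph.indepSumAvoiding, SimpleGraph.indepSumContaining,
      SimpleGraph.IsIndepFinset, huniv]

/-- Join the roots of two rooted trees by an edge and keep the first root. -/
lemma link (h : IsRootedTreeValue x m P Q) (h' : IsRootedTreeValue x m' P' Q') :
    IsRootedTreeValue x (m + m') (P * (P' + Q')) (Q * P') := by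
  obtain ⟨V, _, G, r, rfl, hG, rfl, rfl⟩ := h
  obtain ⟨W, _, H, q, rfl, hH, rfl, rfl⟩ := h'
  exact ⟨V ⊕ W, inferInstance, _, .inl r, Fintype.card_sum, hG.sum_sup_edge hH,
    G.indepSumAvoiding_sum_sup_edge H r q x, G.indepSumContaining_sum_sup_edge H r q x⟩

/-- A rooted tree on which the independence polynomial vanishes can be enlarged. -/
lemma exists_large (hx : x ≠ 0) (hP : P ≠ 0) (h : IsRootedTreeValue x m P (-P)) (N : ℕ) :
    ∃ m' P', N ≤ m' ∧ P' ≠ 0 ∧ IsRootedTreeValue x m' P' (-P') := by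
  induction N with
  | zero => exact ⟨m, P, Nat.zero_le _, hP, h⟩
  | succ N ih =>
    obtain ⟨k, R, hk, hR, hR'⟩ := ih
    refine ⟨k + (1 + (1 + k)), R * (x * R), by omega, by positivity, ?_⟩
    convert hR'.link ((single x).link ((single x).link hR')) using 1 <;> ring

lemma exists_tree (h : IsRootedTreeValue x m P (-P)) :
    ∃ T : SimpleGraph (Fin m), T.IsTree ∧ (indepPoly T).eval x = 0 := by
  obtain ⟨V, _, G, r, rfl, hG, rfl, hQ⟩ := h
  let e := SimpleGraph.Iso.map (Fintype.equivFin V) G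
  refine ⟨_, e.isTree_iff.1 hG, ?_⟩
  rw [SimpleGraph.eval_indepPoly_of_iso e, SimpleGraph.eval_indepPoly,
    ← G.indepSumAvoiding_add_indepSumContaining r, hQ, add_neg_cancel]

end IsRootedTreeValue

/-- `w` is the ratio, over the forest left after deleting the root of some tree, of the
independent-set sum of the forest to that of the forest with its own roots deleted. -/
def IsForestRatio (x w : ℂ) : Prop :=
  ∃ m P Q, IsRootedTreeValue x m P Q ∧ P ≠ 0 ∧ Q ≠ 0 ∧ x * P = w * Q

/-- A forest ratio such that multiplication by it preserves forest ratios. -/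
def IsMultiplier (x w : ℂ) : Prop :=
  IsForestRatio x w ∧ ∀ u, IsForestRatio x u → IsForestRatio x (u * w)

lemma IsForestRatio.mul_one_add_div {x u w : ℂ} (hx : x ≠ 0) (hu : IsForestRatio x u)
    (hw : IsForestRatio x w) (hwx : w + x ≠ 0) : IsForestRatio x (u * (1 + x / w)) := by
  obtain ⟨m, P, Q, h, hP, hQ, hPQ⟩ := hu
  obtain ⟨m', P', Q', h', hP', hQ', hPQ'⟩ := hw
  have hw0 : w ≠ 0 := by
    rintro rfl
    simp_all
  have hQ'_eq : Q' = x * P' / w := by field_simp; rw [hPQ']; ring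
  refine ⟨_, _, _, h.link h', mul_ne_zero hP ?_, mul_ne_zero hQ hP', ?_⟩
  · have : P' + Q' = P' * (w + x) / w := by rw [hQ'_eq]; field_simp
    rw [this]
    exact div_ne_zero (mul_ne_zero hP' hwx) hw0
  · rw [hQ'_eq]
    linear_combination (P' + x * P' / w) * hPQ

namespace IsMultiplier

variable {x u w : ℂ}

lemma one (hx : x ≠ 0) : IsMultiplier x 1 :=
  ⟨⟨1, 1, x, .single x, one_ne_zero, hx, by ring⟩, fun u hu => by rwa [mul_one]⟩

lemma mul (hu : IsMultiplier x u) (hw : IsMultiplier x w) : IsMultiplier x (u * w) :=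
  ⟨hw.2 u hu.1, fun v hv => by
    rw [← mul_assoc]
    exact hw.2 _ (hu.2 v hv)⟩

lemma add (hx : x ≠ 0) (hw : IsMultiplier x w) (hw0 : w ≠ 0) (hwx : w + x ≠ 0) :
    IsMultiplier x (w + x) := by
  have hmul : w + x = w * (1 + x / w) := by field_simp
  rw [hmul]
  refine ⟨hw.1.mul_one_add_div hx hw.1 hwx, fun u hu => ?_⟩
  rw [← mul_assoc]
  exact (hw.2 u hu).mul_one_add_div hx hw.1 hwx

lemma add_natCast_mul (hx : x ≠ 0) (hw : IsMultiplier x w) (j : ℕ)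
    (hne : ∀ i ≤ j, w + i * x ≠ 0) : IsMultiplier x (w + j * x) := by
  induction j with
  | zero => simpa using hw
  | succ j ih =>
    have h := (ih fun i hi => hne i (by omega)).add hx (hne j (by omega))
    have heq : w + j * x + x = w + (j + 1 : ℕ) * x := by push_cast; ring
    rw [heq] at h
    exact h (hne _ le_rfl)

end IsMultiplier

lemma isForestRatio_neg_I_div {k : ℕ} (hk : k ≠ 0) :
    IsForestRatio (Complex.I / k) (-(Complex.I / k)) := by
  have hk' : (k : ℂ) ≠ 0 := Nat.cast_ne_zero.2 hk
  have hx : Complex.I / k ≠ 0 := div_ne_zero Complex.I_ne_zero hk'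
  have h₁ : IsMultiplier (Complex.I / k) (1 + k * (Complex.I / k)) := by
    refine (IsMultiplier.one hx).add_natCast_mul hx k fun i _ h => ?_
    simpa using congrArg Complex.re h
  rw [mul_div_cancel₀ _ hk'] at h₁
  have h₂ : IsMultiplier (Complex.I / k) (-8 * Complex.I) := by
    have hpow : -8 * Complex.I = (1 + Complex.I) * (1 + Complex.I) *
        ((1 + Complex.I) * (1 + Complex.I)) * ((1 + Complex.I) * (1 + Complex.I)) := by
      ring_nf
      simp [Complex.ext_iff, pow_succ]
      norm_num
    rw [hpow]
    exact ((h₁.mul h₁).mul (h₁.mul h₁)).mul (h₁.mul h₁)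
  have h₃ := (h₂.add_natCast_mul hx (8 * k - 1) fun i hi h => ?_).1
  · have hcast : ((8 * k - 1 : ℕ) : ℂ) = 8 * k - 1 := by
      rw [Nat.cast_sub (by omega)]
      push_cast
      ring
    rw [hcast] at h₃
    convert h₃ using 1
    field_simp
    ring
  · have heq : (i : ℂ) * Complex.I = (8 * k : ℕ) * Complex.I := by
      field_simp at h
      push_cast
      linear_combination h
    have := Nat.cast_injective (mul_right_cancel₀ Complex.I_ne_zero heq)
    omega

/-- For every nonzero integer `n` there are infinitely many (pairwise non-isomorphic) trees
with independence roots at `i/n` and `−i/n`: trees with these roots exist with arbitrarily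
large order (and trees of distinct orders are non-isomorphic, while only finitely many trees
exist of each order). -/
theorem infinitely_many_trees_with_root_I_div_n (n : ℤ) (hn : n ≠ 0) :
    ∀ N : ℕ, ∃ (m : ℕ) (T : SimpleGraph (Fin m)),
      N ≤ m ∧ T.Connected ∧ T.IsAcyclic ∧
      (indepPoly T).eval (Complex.I / n) = 0 ∧
      (indepPoly T).eval (-(Complex.I / n)) = 0 := by
  intro N
  obtain ⟨m, P, Q, h, hP, -, hPQ⟩ := isForestRatio_neg_I_div (Int.natAbs_ne_zero.2 hn)
  have hx : Complex.I / (n.natAbs : ℂ) ≠ 0 :=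
    div_ne_zero Complex.I_ne_zero (Nat.cast_ne_zero.2 (Int.natAbs_ne_zero.2 hn))
  obtain rfl : Q = -P := mul_left_cancel₀ hx (by linear_combination hPQ)
  obtain ⟨m', P', hm', -, h'⟩ := h.exists_large hx hP N
  obtain ⟨T, hT, hroot⟩ := h'.exists_tree
  have hconj := T.eval_conj_indepPoly (Complex.I / (n.natAbs : ℂ))
  rw [hroot, map_zero, map_div₀, Complex.conj_I, Complex.conj_natCast, neg_div] at hconj
  refine ⟨m', T, hm', hT.connected, hT.isAcyclic, ?_⟩
  obtain hn' | hn' := Int.natAbs_eq n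
  · have hcast : (n : ℂ) = n.natAbs := by
      simpa only [Int.cast_neg, Int.cast_natCast] using congrArg (Int.cast : ℤ → ℂ) hn'
    rw [hcast]
    exact ⟨hroot, hconj⟩
  · have hcast : (n : ℂ) = -n.natAbs := by
      simpa only [Int.cast_neg, Int.cast_natCast] using congrArg (Int.cast : ℤ → ℂ) hn'
    rw [hcast, div_neg, neg_neg]
    exact ⟨hconj, hroot⟩
end
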